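/- arXiv:2006.02429 — 2 statements merged into one kernel-verified Lean document; each statement's English description precedes it below -/
import Mathlib

section
/- Let t_0 < t_1 < ⋯ be elements of ℤ^d (lexicographic order) with t_0 > 0, t_n > 3t_{n-1} for all n ≥ 1, and such that some t_n has all coordinates positive. Let W = {t_n : n ≥ 0} ∪ {0} ∪ {-t_n : n ≥ 0}. Then there exists a symmetric subset E of ℤ^d containing 0 (i.e., E = -E and 0 ∈ E) such that (W, E) is a co-minimal pair in ℤ^d. -/
open Pointwise

/-- `ℤ^d` equipped with the lexicographic order. -/
abbrev Zd (d : ℕ) := Lex (Fin d → ℤ)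

/-- the value `t (n-1)` with the convention `t_{-1} = 0`. -/
def tprev {d : ℕ} (t : ℕ → Zd d) : ℕ → Zd d := fun n => if n = 0 then 0 else t (n - 1)

/-- `I_n = X_{-t_n, -t_{n-1}}`. -/
def Iset {d : ℕ} (t : ℕ → Zd d) (n : ℕ) : Set (Zd d) :=
  {x | -(t n) ≤ x} \ {x | -(tprev t n) ≤ x}

/-- `J_n = X_{-t_n, -t_{n-1} - t_{n-2}}`. -/
def Jset {d : ℕ} (t : ℕ → Zd d) (n : ℕ) : Set (Zd d) :=
  {x | -(t n) ≤ x} \ {x | -(tprev t n + tprev t (n - 1)) ≤ x}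

/-- `W = {t_n : n ≥ 0} ∪ {0} ∪ {-t_n : n ≥ 0}`. -/
def Wset {d : ℕ} (t : ℕ → Zd d) : Set (Zd d) :=
  Set.range t ∪ {0} ∪ -(Set.range t)

/-- `V = {t_n : n ≥ 0} ∪ {-t_n : n ≥ 0}`. -/
def Vset {d : ℕ} (t : ℕ → Zd d) : Set (Zd d) :=
  Set.range t ∪ -(Set.range t)

/-- `(A, B)` is a co-minimal pair: `A + B = G` and removing any single element of
`A` or of `B` destroys the complement property. -/
def IsCoMinimalPair {G : Type*} [AddCommGroup G] (A B : Set G) : Prop :=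
  A + B = Set.univ ∧
  (∀ a ∈ A, (A \ {a}) + B ≠ Set.univ) ∧
  (∀ b ∈ B, A + (B \ {b}) ≠ Set.univ)

/-- The set `{t n} ∪ {0} ∪ {-t n}` in an arbitrary abelian group. -/
def symmRange {G : Type*} [AddCommGroup G] (t : ℕ → G) : Set G :=
  Set.range t ∪ {0} ∪ -(Set.range t)

theorem mem_symmRange {G : Type*} [AddCommGroup G] {t : ℕ → G} {w : G} :
    w ∈ symmRange t ↔ w = 0 ∨ ∃ n, w = t n ∨ w = -t n := by
  simp only [symmRange, Set.mem_union, Set.mem_range, Set.mem_singleton_iff, Set.mem_neg]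
  constructor
  · rintro ((⟨n, rfl⟩ | h) | ⟨n, h⟩)
    · exact Or.inr ⟨n, Or.inl rfl⟩
    · exact Or.inl h
    · exact Or.inr ⟨n, Or.inr (by rw [h, neg_neg])⟩
  · rintro (h | ⟨n, rfl | rfl⟩)
    · exact Or.inl (Or.inr h)
    · exact Or.inl (Or.inl ⟨n, rfl⟩)
    · exact Or.inr ⟨n, (neg_neg _).symm⟩

theorem neg_mem_symmRange {G : Type*} [AddCommGroup G] {t : ℕ → G} {w : G}
    (hw : w ∈ symmRange t) : -w ∈ symmRange t := by
  rw [mem_symmRange] at hw ⊢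
  rcases hw with rfl | ⟨n, rfl | rfl⟩
  · simp
  · exact Or.inr ⟨n, Or.inr rfl⟩
  · exact Or.inr ⟨n, Or.inl (neg_neg _)⟩

/-- A symmetric family `P` of pairs `(e, w)` with `w ∈ W` such that the sum `e + w` has no other
representation as an element of `W` plus a first component of `P`. -/
structure IsWitnessFamily {G : Type*} [AddCommGroup G] (W : Set G) (P : Set (G × G)) : Prop where
  zero_mem : (0, 0) ∈ P
  neg_mem : ∀ p ∈ P, -p ∈ P
  snd_mem : ∀ p ∈ P, p.2 ∈ W
  fst_eq : ∀ p ∈ P, ∀ q ∈ P, ∀ w ∈ W, q.1 + w = p.1 + p.2 → q.1 = p.1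

namespace IsWitnessFamily

variable {G : Type*} [AddCommGroup G] {W : Set G} {P : Set (G × G)}

theorem insert_pair (hW : ∀ w ∈ W, -w ∈ W) (hP : IsWitnessFamily W P) {e w : G} (hw : w ∈ W)
    (hold : ∀ p ∈ P, ∀ v ∈ W, e + v ≠ p.1 + p.2)
    (hnew : ∀ p ∈ P, ∀ v ∈ W, p.1 + v ≠ e + w)
    (hself : ∀ v ∈ W, -e + v ≠ e + w) :
    IsWitnessFamily W (P ∪ {(e, w), -(e, w)}) where
  zero_mem := Or.inl hP.zero_mem
  neg_mem := by
    rintro p (hp | rfl | rfl)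
    · exact Or.inl (hP.neg_mem p hp)
    · exact Or.inr (Or.inr rfl)
    · exact Or.inr (Or.inl (neg_neg _))
  snd_mem := by
    rintro p (hp | rfl | rfl)
    · exact hP.snd_mem p hp
    · exact hw
    · exact hW w hw
  fst_eq := by
    rintro p (hp | rfl | rfl) q (hq | rfl | rfl) v hv h
    · exact hP.fst_eq p hp q hq v hv h
    · exact absurd h (hold p hp v hv)
    · refine absurd ?_ (hold _ (hP.neg_mem p hp) (-v) (hW v hv))
      simp only [Prod.fst_neg, Prod.snd_neg] at h ⊢
      rw [← neg_add, ← h]; abel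
    · exact absurd h (hnew q hq v hv)
    · rfl
    · exact absurd h (hself v hv)
    · refine absurd ?_ (hnew _ (hP.neg_mem q hq) (-v) (hW v hv))
      simp only [Prod.fst_neg, Prod.snd_neg] at h ⊢
      rw [← neg_add, h]; abel
    · refine absurd ?_ (hself (-v) (hW v hv))
      simp only [Prod.fst_neg, Prod.snd_neg] at h ⊢
      rw [← neg_add, h]; abel
    · rfl

theorem singleton_zero (h0 : (0 : G) ∈ W) : IsWitnessFamily W {((0 : G), (0 : G))} where
  zero_mem := rfl
  neg_mem := by rintro p rfl; simp
  snd_mem := by rintro p rfl; exact h0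
  fst_eq := by rintro p rfl q rfl v hv h; rfl

theorem sUnion {S : Set (Set (G × G))} (hne : S.Nonempty) (hdir : DirectedOn (· ⊆ ·) S)
    (h : ∀ P ∈ S, IsWitnessFamily W P) : IsWitnessFamily W (⋃₀ S) where
  zero_mem := let ⟨P, hP⟩ := hne; ⟨P, hP, (h P hP).zero_mem⟩
  neg_mem := by rintro p ⟨P, hP, hp⟩; exact ⟨P, hP, (h P hP).neg_mem p hp⟩
  snd_mem := by rintro p ⟨P, hP, hp⟩; exact (h P hP).snd_mem p hp
  fst_eq := by
    rintro p ⟨P, hP, hp⟩ q ⟨Q, hQ, hq⟩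
    obtain ⟨R, hR, hPR, hQR⟩ := hdir P hP Q hQ
    exact (h R hR).fst_eq p (hPR hp) q (hQR hq)

theorem isCoMinimalPair (hP : IsWitnessFamily W P) (hcover : ∀ g, ∃ p ∈ P, ∃ w ∈ W, p.1 + w = g)
    (hall : ∀ w ∈ W, ∃ e, (e, w) ∈ P) : IsCoMinimalPair W (Prod.fst '' P) := by
  refine ⟨?_, ?_, ?_⟩
  · refine Set.eq_univ_of_forall fun g => ?_
    obtain ⟨p, hp, w, hw, h⟩ := hcover g
    exact ⟨w, hw, p.1, ⟨p, hp, rfl⟩, (add_comm _ _).trans h⟩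
  · intro w hw huniv
    obtain ⟨e, he⟩ := hall w hw
    obtain ⟨v, ⟨hv, hvw⟩, _, ⟨q, hq, rfl⟩, h⟩ := huniv.ge (Set.mem_univ (e + w))
    have hsum : q.1 + v = e + w := (add_comm _ _).trans h
    have hqe : q.1 = e := hP.fst_eq _ he q hq v hv hsum
    rw [hqe] at hsum
    exact hvw (add_left_cancel hsum)
  · rintro _ ⟨p, hp, rfl⟩ huniv
    obtain ⟨v, hv, _, ⟨⟨q, hq, rfl⟩, hne⟩, h⟩ := huniv.ge (Set.mem_univ (p.1 + p.2))
    exact hne (hP.fst_eq p hp q hq v hv ((add_comm _ _).trans h))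

end IsWitnessFamily

section Ordered

variable {G : Type*} [AddCommGroup G] [LinearOrder G] [IsOrderedAddMonoid G] {t : ℕ → G}

theorem le_or_eq_or_ge_of_mem_symmRange (hmono : StrictMono t) (hpos : 0 < t 0) {w : G}
    (hw : w ∈ symmRange t) (m : ℕ) : w ≤ t m ∨ w = t (m + 1) ∨ t (m + 2) ≤ w := by
  have hp (n : ℕ) : 0 < t n := hpos.trans_le (hmono.monotone (Nat.zero_le n))
  rcases mem_symmRange.1 hw with rfl | ⟨n, rfl | rfl⟩
  · exact Or.inl (hp m).le
  · rcases lt_trichotomy n (m + 1) with h | rfl | h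
    · exact Or.inl (hmono.monotone (by omega))
    · exact Or.inr (Or.inl rfl)
    · exact Or.inr (Or.inr (hmono.monotone (by omega)))
  · exact Or.inl ((neg_lt_zero.2 (hp n)).trans (hp m)).le

omit [IsOrderedAddMonoid G] in
theorem exists_bound_of_finite (hcof : ∀ x, ∃ n, x < t n) {P : Set (G × G)} (hP : P.Finite)
    (c : G) : ∃ m, ∀ p ∈ P, |p.1| < t m ∧ |p.1 + p.2 + c| < t m := by
  obtain ⟨b, hb⟩ := (hP.image fun p => max |p.1| |p.1 + p.2 + c|).bddAbove
  obtain ⟨m, hm⟩ := hcof b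
  exact ⟨m, fun p hp => max_lt_iff.1 ((hb ⟨p, hp, rfl⟩).trans_lt hm)⟩

variable (hmono : StrictMono t) (hpos : 0 < t 0) (hgrow : ∀ n : ℕ, 3 • t n < t (n + 1))
  (hcof : ∀ x, ∃ n, x < t n) {P : Set (G × G)}

include hmono hpos hgrow hcof

theorem IsWitnessFamily.exists_superset_cover (hP : IsWitnessFamily (symmRange t) P)
    (hfin : P.Finite) (g : G) :
    ∃ Q, IsWitnessFamily (symmRange t) Q ∧ Q.Finite ∧ P ⊆ Q ∧
      ∃ p ∈ Q, ∃ w ∈ symmRange t, p.1 + w = g := by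
  by_cases hcov : ∃ p ∈ P, ∃ w ∈ symmRange t, p.1 + w = g
  · exact ⟨P, hP, hfin, subset_rfl, hcov⟩
  push Not at hcov
  obtain ⟨m, hm⟩ := exists_bound_of_finite hcof hfin (-g)
  have hg0 := (hm _ hP.zero_mem).2
  have hpm : 0 < t m := hpos.trans_le (hmono.monotone (Nat.zero_le m))
  have h1 := hgrow m
  have h2 := hgrow (m + 1)
  have hW : t (m + 1) ∈ symmRange t := mem_symmRange.2 (Or.inr ⟨_, Or.inl rfl⟩)
  have key {v : G} (hv : v ∈ symmRange t) := le_or_eq_or_ge_of_mem_symmRange hmono hpos hv m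
  simp only [abs_lt] at hm hg0
  refine ⟨_, hP.insert_pair (fun _ => neg_mem_symmRange) (e := g - t (m + 1)) hW ?_ ?_ ?_,
    hfin.union (Set.toFinite _), Set.subset_union_left, _, Or.inr (Or.inl rfl), _, hW,
    sub_add_cancel _ _⟩
  · intro p hp v hv h
    have hb := (hm p hp).2
    have hne := hcov p hp p.2 (hP.snd_mem p hp)
    rcases key hv with hle | heq | hge <;> grind
  · intro p hp v hv h
    exact hcov p hp v hv (h.trans (sub_add_cancel _ _))
  · intro v hv h
    have hne := hcov _ hP.zero_mem 0 (mem_symmRange.2 (Or.inl rfl))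
    simp only [add_zero] at hne
    rcases lt_or_gt_of_ne hne with h0 | h0 <;>
    rcases key (neg_mem_symmRange hv) with hle | heq | hge <;> grind

theorem IsWitnessFamily.exists_superset_snd (hP : IsWitnessFamily (symmRange t) P)
    (hfin : P.Finite) {w : G} (hw : w ∈ symmRange t) :
    ∃ Q, IsWitnessFamily (symmRange t) Q ∧ Q.Finite ∧ P ⊆ Q ∧ ∃ e, (e, w) ∈ Q := by
  obtain ⟨m, hm⟩ := exists_bound_of_finite hcof hfin w
  have hw0 := (hm _ hP.zero_mem).2
  have hpm : 0 < t m := hpos.trans_le (hmono.monotone (Nat.zero_le m))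
  have h1 := hgrow m
  have h2 := hgrow (m + 1)
  have key {v : G} (hv : v ∈ symmRange t) := le_or_eq_or_ge_of_mem_symmRange hmono hpos hv m
  simp only [abs_lt] at hm hw0
  refine ⟨_, hP.insert_pair (fun _ => neg_mem_symmRange) (e := t (m + 1) + t m - w) hw ?_ ?_ ?_,
    hfin.union (Set.toFinite _), Set.subset_union_left, _, Or.inr (Or.inl rfl)⟩
  · intro p hp v hv h
    have hb := (hm p hp).2
    rcases key (neg_mem_symmRange hv) with hle | heq | hge <;> grind
  · intro p hp v hv h
    have hb := (hm p hp).1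
    rcases key hv with hle | heq | hge <;> grind
  · intro v hv h
    rcases key hv with hle | heq | hge <;> grind

theorem exists_symmetric_isCoMinimalPair_symmRange [Countable G] :
    ∃ E : Set G, E = -E ∧ (0 : G) ∈ E ∧ IsCoMinimalPair (symmRange t) E := by
  let F := {P : Set (G × G) // IsWitnessFamily (symmRange t) P ∧ P.Finite}
  let D : G ⊕ symmRange t → Order.Cofinal F := Sum.elim
    (fun g => ⟨{P | ∃ p ∈ P.1, ∃ w ∈ symmRange t, p.1 + w = g}, fun P => by
      obtain ⟨Q, hQ, hfin, hPQ, h⟩ :=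
        P.2.1.exists_superset_cover hmono hpos hgrow hcof P.2.2 g
      exact ⟨⟨Q, hQ, hfin⟩, h, hPQ⟩⟩)
    (fun w => ⟨{P | ∃ e, (e, w.1) ∈ P.1}, fun P => by
      obtain ⟨Q, hQ, hfin, hPQ, h⟩ :=
        P.2.1.exists_superset_snd hmono hpos hgrow hcof P.2.2 w.2
      exact ⟨⟨Q, hQ, hfin⟩, h, hPQ⟩⟩)
  let P₀ : F := ⟨_, .singleton_zero (mem_symmRange.2 (Or.inl rfl)), Set.finite_singleton _⟩
  have := Encodable.ofCountable (G ⊕ symmRange t)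
  let I := Order.idealOfCofinals P₀ D
  have hI : IsWitnessFamily (symmRange t) (⋃₀ (Subtype.val '' (I : Set F))) := by
    refine .sUnion (I.nonempty.image _) ?_ ?_
    · rintro _ ⟨P, hP, rfl⟩ _ ⟨Q, hQ, rfl⟩
      obtain ⟨R, hR, hPR, hQR⟩ := I.directed P hP Q hQ
      exact ⟨_, ⟨R, hR, rfl⟩, hPR, hQR⟩
    · rintro _ ⟨P, hP, rfl⟩
      exact P.2.1
  refine ⟨Prod.fst '' _, ?_, ⟨(0, 0), hI.zero_mem, rfl⟩, hI.isCoMinimalPair ?_ ?_⟩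
  · ext x
    constructor
    · rintro ⟨p, hp, rfl⟩
      exact ⟨-p, hI.neg_mem p hp, rfl⟩
    · rintro ⟨p, hp, h⟩
      exact ⟨-p, hI.neg_mem p hp, by rw [Prod.fst_neg, h, neg_neg]⟩
  · intro g
    obtain ⟨P, ⟨p, hp, h⟩, hPI⟩ := Order.cofinal_meets_idealOfCofinals P₀ D (Sum.inl g)
    exact ⟨p, ⟨_, ⟨P, hPI, rfl⟩, hp⟩, h⟩
  · intro w hw
    obtain ⟨P, ⟨e, he⟩, hPI⟩ := Order.cofinal_meets_idealOfCofinals P₀ D (Sum.inr ⟨w, hw⟩)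
    exact ⟨e, _, ⟨P, hPI, rfl⟩, he⟩

end Ordered

theorem exists_lt_of_three_nsmul_lt {d : ℕ} (hd : 0 < d) {t : ℕ → Zd d}
    (hgrow : ∀ n : ℕ, 3 • t n < t (n + 1)) (hcoord : ∃ n : ℕ, ∀ i : Fin d, 0 < ofLex (t n) i)
    (x : Zd d) : ∃ n, x < t n := by
  obtain ⟨N, hN⟩ := hcoord
  have hfirst {a b : Zd d} (h : a ≤ b) : ofLex a ⟨0, hd⟩ ≤ ofLex b ⟨0, hd⟩ :=
    Pi.apply_le_of_toLex (x := ofLex a) (y := ofLex b) (i := ⟨0, hd⟩) h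
      fun j hj => absurd hj (Nat.not_lt_zero j.1)
  have hlin (k : ℕ) : (k : ℤ) + 1 ≤ ofLex (t (N + k)) ⟨0, hd⟩ := by
    induction k with
    | zero => simpa using Int.add_one_le_of_lt (hN ⟨0, hd⟩)
    | succ k ih =>
      have h : 3 • ofLex (t (N + k)) ⟨0, hd⟩ ≤ ofLex (t (N + k + 1)) ⟨0, hd⟩ :=
        hfirst (hgrow (N + k)).le
      rw [← add_assoc, nsmul_eq_mul] at *
      push_cast at *
      linarith
  refine ⟨N + (ofLex x ⟨0, hd⟩).toNat, lt_of_not_ge fun h => ?_⟩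
  have h1 := hfirst h
  have h2 := hlin (ofLex x ⟨0, hd⟩).toNat
  have h3 := Int.self_le_toNat (ofLex x ⟨0, hd⟩)
  linarith

theorem stmt7 {d : ℕ} (hd : 0 < d) (t : ℕ → Zd d) (hmono : StrictMono t)
    (hpos : 0 < t 0) (hgrow : ∀ n : ℕ, 3 • t n < t (n + 1))
    (hcoord : ∃ n : ℕ, ∀ i : Fin d, 0 < ofLex (t n) i) :
    ∃ E : Set (Zd d), E = -E ∧ (0 : Zd d) ∈ E ∧ IsCoMinimalPair (Wset t) E := by
  have : Countable (Zd d) := inferInstanceAs (Countable (Fin d → ℤ))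
  exact exists_symmetric_isCoMinimalPair_symmRange hmono hpos hgrow
    (exists_lt_of_three_nsmul_lt hd hgrow hcoord)
end

section
/- Let t_0 < t_1 < ⋯ in ℤ^d (lexicographic order) with t_0 > 0, t_n ≥ 6t_{n-1} for all n ≥ 1, and some t_n with all coordinates positive. Let V = {±t_n : n ≥ 0}. Then there exists a subset R of ℤ^d \ ℤ^d_{≥0} such that (V, R) is a co-minimal pair in ℤ^d. -/
open Pointwise

/-- A complement `R` of `V` such that every element has only finitely many representations in
`V + R` contains a minimal complement. -/
theorem exists_minimal_complement {G : Type*} [AddCommGroup G] {V R : Set G}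
    (hcomp : ∀ g, ∃ v ∈ V, g - v ∈ R) (hfin : ∀ g, {v ∈ V | g - v ∈ R}.Finite) :
    ∃ S ⊆ R, Minimal (fun S => ∀ g, ∃ v ∈ V, g - v ∈ S) S := by
  have hchains : ∀ c ⊆ {S | S ⊆ R ∧ ∀ g, ∃ v ∈ V, g - v ∈ S}, IsChain (· ⊆ ·) c → c.Nonempty →
      ∃ lb ∈ {S | S ⊆ R ∧ ∀ g, ∃ v ∈ V, g - v ∈ S}, ∀ s ∈ c, lb ⊆ s := by
    intro c hc hchain ⟨s₀, hs₀⟩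
    refine ⟨⋂₀ c, ⟨(Set.sInter_subset_of_mem hs₀).trans (hc hs₀).1, fun g => ?_⟩,
      fun s hs => Set.sInter_subset_of_mem hs⟩
    by_contra! hne
    have hmiss : ∀ F : Finset G, (∀ v ∈ F, v ∈ V) → ∃ s ∈ c, ∀ v ∈ F, g - v ∉ s := by
      classical
      intro F
      induction F using Finset.induction_on with
      | empty => exact fun _ => ⟨s₀, hs₀, by simp⟩
      | insert a F _ ih =>
        intro hF
        obtain ⟨s, hs, hsF⟩ := ih fun v hv => hF v (Finset.mem_insert_of_mem hv)
        obtain ⟨s', hs', has'⟩ : ∃ s ∈ c, g - a ∉ s := by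
          simpa [Set.mem_sInter] using hne a (hF a (Finset.mem_insert_self a F))
        rcases hchain.total hs hs' with hle | hle
        · refine ⟨s, hs, fun v hv => ?_⟩
          rcases Finset.mem_insert.1 hv with rfl | hv
          exacts [fun h => has' (hle h), hsF v hv]
        · refine ⟨s', hs', fun v hv => ?_⟩
          rcases Finset.mem_insert.1 hv with rfl | hv
          exacts [has', fun h => hsF v hv (hle h)]
    obtain ⟨s, hs, hmem⟩ := hmiss (hfin g).toFinset fun v hv => ((hfin g).mem_toFinset.1 hv).1
    obtain ⟨v, hv, hvs⟩ := (hc hs).2 g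
    exact hmem v ((hfin g).mem_toFinset.2 ⟨hv, (hc hs).1 hvs⟩) hvs
  obtain ⟨S, -, hS⟩ := zorn_superset_nonempty _ hchains R ⟨subset_rfl, hcomp⟩
  exact ⟨S, hS.1.1, hS.1.2, fun T hT hTS => hS.2 ⟨hTS.trans hS.1.1, hT⟩ hTS⟩

/-- A complement `R` of `V` in which every element of `V` is needed, and such that every element
has only finitely many representations in `V + R`, can be shrunk to a co-minimal partner. -/
theorem exists_isCoMinimalPair_of_complement {G : Type*} [AddCommGroup G] {V R : Set G}
    (hcomp : ∀ g, ∃ v ∈ V, g - v ∈ R) (hfin : ∀ g, {v ∈ V | g - v ∈ R}.Finite)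
    (huniq : ∀ v ∈ V, ∃ g, ∀ w ∈ V, g - w ∈ R → w = v) :
    ∃ S ⊆ R, IsCoMinimalPair V S := by
  obtain ⟨S, hSR, hS, hmin⟩ := exists_minimal_complement hcomp hfin
  refine ⟨S, hSR, ?_, fun a ha h => ?_, fun b hb h => ?_⟩
  · refine Set.eq_univ_of_forall fun g => ?_
    obtain ⟨v, hv, hg⟩ := hS g
    exact ⟨v, hv, g - v, hg, add_sub_cancel v g⟩
  · obtain ⟨g, hg⟩ := huniq a ha
    obtain ⟨w, ⟨hw, hwa⟩, r, hr, hwr⟩ := h.symm ▸ Set.mem_univ g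
    exact hwa (hg w hw (hSR (by rwa [← hwr, add_sub_cancel_left])))
  · have hle := hmin (y := S \ {b}) (fun g => ?_) Set.sdiff_subset
    · exact (hle hb).2 rfl
    · obtain ⟨w, hw, r, hr, hwr⟩ := h.symm ▸ Set.mem_univ g
      exact ⟨w, hw, by rwa [← hwr, add_sub_cancel_left]⟩

/-- The sequence `t 0, -t 0, t 1, -t 1, …`. -/
def signedSeq {G : Type*} [Neg G] (t : ℕ → G) (N : ℕ) : G :=
  if Even N then t (N / 2) else -t (N / 2)

/-- The translates `h - t (K h)`, except that for `h = -2 t (N + 1)` the translate by the `N`-th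
element of `t 0, -t 0, t 1, -t 1, …` is used. -/
def sparseComplement {G : Type*} [AddCommGroup G] (t : ℕ → G) (K : G → ℕ) : Set G :=
  {x | ∃ h, (∀ N, h ≠ -(2 • t (N + 1))) ∧ x = h - t (K h)} ∪
    {x | ∃ N, x = -(2 • t (N + 1)) - signedSeq t N}

/-- The elements `±t n`. -/
def signedRange {G : Type*} [AddCommGroup G] (t : ℕ → G) : Set G :=
  Set.range t ∪ -Set.range t

theorem signedSeq_mem {G : Type*} [AddCommGroup G] (t : ℕ → G) (N : ℕ) :
    signedSeq t N ∈ signedRange t := by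
  unfold signedSeq
  split_ifs
  · exact Or.inl ⟨_, rfl⟩
  · exact Or.inr ⟨N / 2, (neg_neg _).symm⟩

theorem exists_signedSeq_eq {G : Type*} [AddCommGroup G] {t : ℕ → G} {v : G}
    (hv : v ∈ signedRange t) : ∃ N, signedSeq t N = v := by
  rcases hv with ⟨n, rfl⟩ | ⟨n, hn⟩
  · exact ⟨2 * n, by simp [signedSeq]⟩
  · refine ⟨2 * n + 1, ?_⟩
    have : (2 * n + 1) / 2 = n := by omega
    simp [signedSeq, this, hn]

theorem exists_sub_mem_sparseComplement {G : Type*} [AddCommGroup G] (t : ℕ → G) (K : G → ℕ)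
    (g : G) : ∃ v ∈ signedRange t, g - v ∈ sparseComplement t K := by
  by_cases h : ∃ N, g = -(2 • t (N + 1))
  · obtain ⟨N, rfl⟩ := h
    exact ⟨signedSeq t N, signedSeq_mem t N, Or.inr ⟨N, rfl⟩⟩
  · exact ⟨t (K g), Or.inl ⟨_, rfl⟩, Or.inl ⟨g, not_exists.1 h, rfl⟩⟩

section Growth

variable {G : Type*} [AddCommGroup G] [LinearOrder G]

theorem pos_of_strictMono {t : ℕ → G} (hmono : StrictMono t) (hpos : 0 < t 0) (n : ℕ) :
    0 < t n :=
  hpos.trans_le (hmono.monotone n.zero_le)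

theorem six_nsmul_le_of_lt {t : ℕ → G} (hmono : StrictMono t)
    (hgrow : ∀ n, 6 • t n ≤ t (n + 1)) {m n : ℕ} (h : m < n) : 6 • t m ≤ t n :=
  (hgrow m).trans (hmono.monotone h)

theorem trichotomy_six_nsmul {t : ℕ → G} (hmono : StrictMono t)
    (hgrow : ∀ n, 6 • t n ≤ t (n + 1)) (m n : ℕ) :
    6 • t m ≤ t n ∨ m = n ∨ 6 • t n ≤ t m :=
  (lt_trichotomy m n).imp (six_nsmul_le_of_lt hmono hgrow)
    (Or.imp_right (six_nsmul_le_of_lt hmono hgrow))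

variable [IsOrderedAddMonoid G]

theorem six_nsmul_abs_signedSeq_le {t : ℕ → G} (hmono : StrictMono t) (hpos : 0 < t 0)
    (hgrow : ∀ n, 6 • t n ≤ t (n + 1)) (N : ℕ) : 6 • |signedSeq t N| ≤ t (N + 1) := by
  have := six_nsmul_le_of_lt hmono hgrow (m := N / 2) (n := N + 1) (by omega)
  have := abs_of_pos (pos_of_strictMono hmono hpos (N / 2))
  unfold signedSeq
  split_ifs
  · rwa [this]
  · rwa [abs_neg, this]

/-- Two translates `g - t j` and `h - t k` by large terms agree only trivially. -/
theorem eq_of_sub_eq_sub {t : ℕ → G} (hmono : StrictMono t) (hpos : 0 < t 0)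
    (hgrow : ∀ n, 6 • t n ≤ t (n + 1)) {g h : G} {j k : ℕ} (hg : 6 • |g| ≤ t j)
    (hh : 6 • |h| ≤ t k) (e : g - t j = h - t k) : j = k ∧ g = h := by
  have hj := pos_of_strictMono hmono hpos j
  have hk := pos_of_strictMono hmono hpos k
  have := neg_abs_le g
  have := le_abs_self g
  have := neg_abs_le h
  have := le_abs_self h
  rcases lt_trichotomy j k with hjk | rfl | hjk
  · have := six_nsmul_le_of_lt hmono hgrow hjk
    grind
  · exact ⟨rfl, sub_left_injective e⟩
  · have := six_nsmul_le_of_lt hmono hgrow hjk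
    grind

theorem sub_ne_neg_two_nsmul_sub {t : ℕ → G} (hmono : StrictMono t) (hpos : 0 < t 0)
    (hgrow : ∀ n, 6 • t n ≤ t (n + 1)) {g u : G} {j M : ℕ} (hg : 6 • |g| ≤ t j)
    (hu : 6 • |u| ≤ t M) : g - t j ≠ -(2 • t M) - u := by
  intro e
  have hj := pos_of_strictMono hmono hpos j
  have hM := pos_of_strictMono hmono hpos M
  have := neg_abs_le g
  have := le_abs_self g
  have := neg_abs_le u
  have := le_abs_self u
  rcases lt_trichotomy j M with hjM | rfl | hjM
  · have := six_nsmul_le_of_lt hmono hgrow hjM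
    grind
  · grind
  · have := six_nsmul_le_of_lt hmono hgrow hjM
    grind

theorem neg_of_mem_sparseComplement {t : ℕ → G} {K : G → ℕ} (hmono : StrictMono t)
    (hpos : 0 < t 0) (hgrow : ∀ n, 6 • t n ≤ t (n + 1)) (hK : ∀ g, 6 • |g| ≤ t (K g)) {x : G}
    (hx : x ∈ sparseComplement t K) : x < 0 := by
  rcases hx with ⟨h, -, rfl⟩ | ⟨N, rfl⟩
  · have := pos_of_strictMono hmono hpos (K h)
    have := hK h
    have := le_abs_self h
    have := neg_abs_le h
    grind
  · have := pos_of_strictMono hmono hpos (N + 1)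
    have := six_nsmul_abs_signedSeq_le hmono hpos hgrow N
    have := neg_abs_le (signedSeq t N)
    have := le_abs_self (signedSeq t N)
    grind

theorem finite_setOf_sub_mem_sparseComplement {t : ℕ → G} {K : G → ℕ} (hmono : StrictMono t)
    (hpos : 0 < t 0) (hgrow : ∀ n, 6 • t n ≤ t (n + 1)) (hK : ∀ g, 6 • |g| ≤ t (K g)) (g : G) :
    {v ∈ signedRange t | g - v ∈ sparseComplement t K}.Finite := by
  have key : ∀ v, v ∈ signedRange t ∧ g - v ∈ sparseComplement t K →
      ∃ j ≤ K g, v = t j ∨ v = -t j := by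
    rintro v ⟨⟨j, rfl⟩ | ⟨j, hj⟩, hv⟩
    · refine ⟨j, ?_, Or.inl rfl⟩
      by_contra! hlt
      have hgj := (hK g).trans (hmono hlt).le
      rcases hv with ⟨h, -, e⟩ | ⟨N, e⟩
      · obtain ⟨rfl, rfl⟩ := eq_of_sub_eq_sub hmono hpos hgrow hgj (hK h) e
        exact hlt.false
      · exact sub_ne_neg_two_nsmul_sub hmono hpos hgrow hgj
          (six_nsmul_abs_signedSeq_le hmono hpos hgrow N) e
    · refine ⟨j, ?_, Or.inr (by rw [hj, neg_neg])⟩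
      by_contra! hlt
      have := neg_of_mem_sparseComplement hmono hpos hgrow hK hv
      have := hmono hlt
      have := hK g
      have := neg_abs_le g
      have := abs_nonneg g
      grind
  refine (((Set.finite_Iic (K g)).image t).union
    ((Set.finite_Iic (K g)).image fun j => -t j)).subset fun v hv => ?_
  obtain ⟨j, hj, rfl | rfl⟩ := key v hv
  · exact Or.inl ⟨j, hj, rfl⟩
  · exact Or.inr ⟨j, hj, rfl⟩

theorem neg_two_nsmul_sub_ne_sub {t : ℕ → G} (hmono : StrictMono t) (hpos : 0 < t 0)
    (hgrow : ∀ n, 6 • t n ≤ t (n + 1)) {v h : G} {M k : ℕ} (hv : v ∈ signedRange t)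
    (hh : 6 • |h| ≤ t k) (hh₀ : h = 0 → k ≠ M) (hne : h ≠ -(2 • t M)) :
    -(2 • t M) - v ≠ h - t k := by
  intro e
  have hM := pos_of_strictMono hmono hpos M
  have hk := pos_of_strictMono hmono hpos k
  have := neg_abs_le h
  have := le_abs_self h
  rcases hv with ⟨j, rfl⟩ | ⟨j, hj⟩
  · have hj := pos_of_strictMono hmono hpos j
    have hjk := trichotomy_six_nsmul hmono hgrow j k
    have hkM := trichotomy_six_nsmul hmono hgrow k M
    have hjM := trichotomy_six_nsmul hmono hgrow j M
    rcases hjM with hjM | rfl | hjM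
    · rcases hkM with hkM | rfl | hkM <;> grind
    · rcases hkM with hkM | rfl | hkM <;> grind
    · rcases hjk with hjk | rfl | hjk
      · grind
      · exact hne (by grind)
      · grind
  · obtain rfl : v = -t j := by rw [hj, neg_neg]
    have hj := pos_of_strictMono hmono hpos j
    have hkM := trichotomy_six_nsmul hmono hgrow k M
    rcases trichotomy_six_nsmul hmono hgrow j M with hjM | rfl | hjM
    · rcases hkM with hkM | rfl | hkM <;> grind
    · rcases hkM with hkM | rfl | hkM
      · grind
      · exact hh₀ (by grind) rfl
      · grind
    · grind

theorem signedSeq_eq_of_sub_eq_sub {t : ℕ → G} (hmono : StrictMono t) (hpos : 0 < t 0)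
    (hgrow : ∀ n, 6 • t n ≤ t (n + 1)) {v : G} {M N : ℕ} (hv : v ∈ signedRange t)
    (e : -(2 • t (M + 1)) - v = -(2 • t (N + 1)) - signedSeq t N) : v = signedSeq t M := by
  have hu := six_nsmul_abs_signedSeq_le hmono hpos hgrow N
  have := neg_abs_le (signedSeq t N)
  have := le_abs_self (signedSeq t N)
  have hM := pos_of_strictMono hmono hpos (M + 1)
  have hN := pos_of_strictMono hmono hpos (N + 1)
  rcases eq_or_ne M N with rfl | hne
  · exact sub_right_injective e
  have hMN := trichotomy_six_nsmul hmono hgrow (M + 1) (N + 1)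
  obtain ⟨j, hj⟩ : ∃ j, v = t j ∨ v = -t j := by
    rcases hv with ⟨j, rfl⟩ | ⟨j, hj⟩
    exacts [⟨j, Or.inl rfl⟩, ⟨j, Or.inr (by rw [hj, neg_neg])⟩]
  have htj := pos_of_strictMono hmono hpos j
  exfalso
  rcases hMN with hMN | hMN | hMN
  · rcases trichotomy_six_nsmul hmono hgrow j (N + 1) with h | rfl | h <;>
      rcases hj with rfl | rfl <;> grind
  · omega
  · rcases trichotomy_six_nsmul hmono hgrow j (M + 1) with h | rfl | h <;>
      rcases hj with rfl | rfl <;> grind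

theorem exists_isCoMinimalPair_signedRange {t : ℕ → G} (hmono : StrictMono t) (hpos : 0 < t 0)
    (hgrow : ∀ n, 6 • t n ≤ t (n + 1)) (hcof : ∀ g, ∃ n, g ≤ t n) :
    ∃ R : Set G, R ⊆ {x | ¬ 0 ≤ x} ∧ IsCoMinimalPair (signedRange t) R := by
  classical
  have hlarge : ∀ g, ∃ n, 6 • |g| ≤ t n := fun g => hcof _
  have hK : ∀ g, 6 • |g| ≤ t (Nat.find (hlarge g)) := fun g => Nat.find_spec (hlarge g)
  have hK₀ : Nat.find (hlarge 0) = 0 := (Nat.find_eq_zero _).2 (by simpa using hpos.le)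
  obtain ⟨R, hR, hVR⟩ := exists_isCoMinimalPair_of_complement
    (exists_sub_mem_sparseComplement t fun g => Nat.find (hlarge g))
    (finite_setOf_sub_mem_sparseComplement hmono hpos hgrow hK) fun v hv => by
      obtain ⟨M, rfl⟩ := exists_signedSeq_eq hv
      refine ⟨-(2 • t (M + 1)), fun w hw hmem => ?_⟩
      rcases hmem with ⟨h, hne, e⟩ | ⟨N, e⟩
      · refine absurd e (neg_two_nsmul_sub_ne_sub hmono hpos hgrow hw (hK h) ?_ (hne M))
        rintro rfl
        exact fun h₀ => Nat.succ_ne_zero M (h₀.symm.trans hK₀)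
      · exact signedSeq_eq_of_sub_eq_sub hmono hpos hgrow hw e
  exact ⟨R, fun x hx => (neg_of_mem_sparseComplement hmono hpos hgrow hK (hR hx)).not_ge, hVR⟩

theorem nsmul_le_add {t : ℕ → G} (hmono : StrictMono t) (hpos : 0 < t 0)
    (hgrow : ∀ n, 6 • t n ≤ t (n + 1)) (n k : ℕ) : k • t n ≤ t (n + k) := by
  induction k with
  | zero => simpa using (pos_of_strictMono hmono hpos n).le
  | succ k ih =>
    have hk := (pos_of_strictMono hmono hpos (n + k)).le
    calc (k + 1) • t n = k • t n + t n := succ_nsmul _ _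
      _ ≤ t (n + k) + t (n + k) := add_le_add ih (hmono.monotone (Nat.le_add_right n k))
      _ = 2 • t (n + k) := (two_nsmul _).symm
      _ ≤ 6 • t (n + k) := nsmul_le_nsmul_left hk (by norm_num)
      _ ≤ t (n + (k + 1)) := hgrow (n + k)

end Growth

/-- If some `t n` has positive first coordinate, then `t` is cofinal in `ℤ^d`. -/
theorem exists_le_of_coord_pos {d : ℕ} (i : Fin d) (hi : ∀ j, ¬ j < i) {t : ℕ → Zd d}
    (hmono : StrictMono t) (hpos : 0 < t 0) (hgrow : ∀ n, 6 • t n ≤ t (n + 1)) {n : ℕ}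
    (hn : 0 < ofLex (t n) i) (g : Zd d) : ∃ m, g ≤ t m := by
  refine ⟨_, le_trans (le_of_lt ?_) (nsmul_le_add hmono hpos hgrow n ((ofLex g i).natAbs + 1))⟩
  refine ⟨i, fun j hj => absurd hj (hi j), ?_⟩
  change ofLex g i < ((ofLex g i).natAbs + 1) • ofLex (t n) i
  rw [nsmul_eq_mul]
  push_cast
  have := le_abs_self (ofLex g i)
  nlinarith [abs_nonneg (ofLex g i)]

theorem stmt12 {d : ℕ} (hd : 0 < d) (t : ℕ → Zd d) (hmono : StrictMono t)
    (hpos : 0 < t 0) (hgrow : ∀ n : ℕ, 6 • t n ≤ t (n + 1))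
    (hcoord : ∃ n : ℕ, ∀ i : Fin d, 0 < ofLex (t n) i) :
    ∃ R : Set (Zd d), R ⊆ {x : Zd d | ¬ (0 : Zd d) ≤ x} ∧
      IsCoMinimalPair (Vset t) R := by
  obtain ⟨n, hn⟩ := hcoord
  exact exists_isCoMinimalPair_signedRange hmono hpos hgrow
    (exists_le_of_coord_pos ⟨0, hd⟩ (fun j hj => Nat.not_lt_zero _ hj) hmono hpos hgrow (hn _))
end
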